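/- In the setting of the Lyapunov convergence theorem (hypotheses (i), (ii) and the DR-sequence condition below), suppose additionally that the closure of D intersected with f⁻¹(0) is a singleton {x̄} contained in D, and that F is continuous at x̄. Then the DR sequence (z_n) converges to a point z̄ with P_A(z̄) = (x̄, 0) ∈ A ∩ B. If moreover f is strictly differentiable at x̄ with ∇f(x̄) ≠ 0 and the restriction of f to D is continuous at x̄, then (z_n) converges to (x̄, 0) ∈ A ∩ B itself. -/

import Mathlib

open Set Metric Filter
open scoped InnerProductSpace

/-- The Euclidean (ℓ²) distance on the product `X × ℝ`. -/
noncomputable def dist2 {X : Type*} [NormedAddCommGroup X] (z w : X × ℝ) : ℝ :=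
  Real.sqrt (‖z.1 - w.1‖ ^ 2 + (z.2 - w.2) ^ 2)

/-- The graph `B = {(x, ρ) : x ∈ dom f, f(x) = ρ}` of the extended-real-valued function
encoded by its effective domain `s` and its real values `f` on `s`. -/
def grph {X : Type*} (s : Set X) (f : X → ℝ) : Set (X × ℝ) :=
  {p | p.1 ∈ s ∧ f p.1 = p.2}

/-- The (possibly set-valued) projector onto the graph `B`, for the Euclidean metric on
`X × ℝ`: the set of points of `B` nearest to `z`. -/
noncomputable def projB {X : Type*} [NormedAddCommGroup X] (s : Set X) (f : X → ℝ)
    (z : X × ℝ) : Set (X × ℝ) :=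
  {b | b ∈ grph s f ∧ ∀ b' ∈ grph s f, dist2 z b ≤ dist2 z b'}

/-- The reflector across `A = X × {0}`: `R_A(x, ρ) = (x, -ρ)`. -/
def reflA {X : Type*} (z : X × ℝ) : X × ℝ := (z.1, -z.2)

/-- The Douglas–Rachford operator `T_{A,B}(z) = {(z + w)/2 : w ∈ R_B(R_A z)}`,
where `R_B(v) = {2b - v : b ∈ P_B(v)}`. -/
noncomputable def drT {X : Type*} [NormedAddCommGroup X] [Module ℝ X] (s : Set X)
    (f : X → ℝ) (z : X × ℝ) : Set (X × ℝ) :=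
  {w | ∃ b ∈ projB s f (reflA z), w = (2 : ℝ)⁻¹ • (z + (2 • b - reflA z))}

/-- The convex subdifferential of the extended function encoded by `(sF, F)` at `p`. -/
def subdiff {X : Type*} [NormedAddCommGroup X] [InnerProductSpace ℝ X]
    (sF : Set X) (F : X → ℝ) (p : X) : Set X :=
  {v | p ∈ sF ∧ ∀ y ∈ sF, F p + ⟪v, y - p⟫_ℝ ≤ F y}

/-- Strict (Fréchet) differentiability of the extended function encoded by `(s, f)` at
`y`, with gradient `g`. -/
def sdiffAt {X : Type*} [NormedAddCommGroup X] [InnerProductSpace ℝ X]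
    (s : Set X) (f : X → ℝ) (g : X) (y : X) : Prop :=
  (∃ ε > 0, Metric.ball y ε ⊆ s) ∧ HasStrictFDerivAt f (innerSL ℝ g) y

/-- A real sequence whose squares converge and whose increments vanish converges. -/
theorem exists_tendsto_of_sq_of_increments {u : ℕ → ℝ} {L : ℝ}
    (hsq : Tendsto (fun n => u n ^ 2) atTop (nhds L))
    (hinc : Tendsto (fun n => u (n + 1) - u n) atTop (nhds 0)) :
    ∃ l, Tendsto u atTop (nhds l) := by
  have habs : Tendsto (fun n => |u n|) atTop (nhds (Real.sqrt L)) := by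
    simpa only [Real.sqrt_sq_eq_abs] using hsq.sqrt
  rcases (Real.sqrt_nonneg L).eq_or_lt with h0 | hr
  · exact ⟨0, (tendsto_zero_iff_abs_tendsto_zero u).2 (by simpa [h0, Function.comp_def] using habs)⟩
  set r := Real.sqrt L
  obtain ⟨N, hN⟩ := eventually_atTop.1 ((habs.eventually_const_lt (half_lt_self hr)).and
    ((tendsto_zero_iff_abs_tendsto_zero _).1 hinc |>.eventually_lt_const (half_pos hr)))
  simp only [Function.comp_apply] at hN
  rcases le_or_gt 0 (u N) with hs | hs
  · have hpos : ∀ n ≥ N, 0 ≤ u n := by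
      intro n hn
      induction n, hn using Nat.le_induction with
      | base => exact hs
      | succ n hn ih =>
        have h1 := (hN n hn).1
        rw [abs_of_nonneg ih] at h1
        linarith [(abs_lt.1 (hN n hn).2).1]
    refine ⟨r, habs.congr' ?_⟩
    filter_upwards [eventually_ge_atTop N] with n hn using abs_of_nonneg (hpos n hn)
  · have hneg : ∀ n ≥ N, u n ≤ 0 := by
      intro n hn
      induction n, hn using Nat.le_induction with
      | base => exact hs.le
      | succ n hn ih =>
        have h1 := (hN n hn).1
        rw [abs_of_nonpos ih] at h1
        linarith [(abs_lt.1 (hN n hn).2).2]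
    refine ⟨-r, habs.neg.congr' ?_⟩
    filter_upwards [eventually_ge_atTop N] with n hn
    rw [abs_of_nonpos (hneg n hn), neg_neg]

/-- One step of the Douglas–Rachford iteration: the second coordinate is increased by the
value of `f` at the new first coordinate, which minimizes `‖x - z.1‖² + (f x + z.2)²`. -/
theorem drT_step {X : Type*} [NormedAddCommGroup X] [InnerProductSpace ℝ X]
    {s : Set X} {f : X → ℝ} {z w : X × ℝ} (h : w ∈ drT s f z) :
    w.1 ∈ s ∧ w.2 = z.2 + f w.1 ∧
      ∀ x ∈ s, ‖w.1 - z.1‖ ^ 2 + (f w.1 + z.2) ^ 2 ≤ ‖x - z.1‖ ^ 2 + (f x + z.2) ^ 2 := by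
  obtain ⟨⟨y, t⟩, ⟨⟨hys, hyt⟩, hmin⟩, rfl⟩ := h
  simp only at hys hyt
  subst hyt
  have hfst : ((2 : ℝ)⁻¹ • (z + (2 • ((y, f y) : X × ℝ) - reflA z))).1 = y := by
    simp only [reflA, Prod.smul_fst, Prod.fst_add, Prod.fst_sub, add_sub_cancel]
    rw [two_nsmul, ← two_smul ℝ y, smul_smul]
    norm_num
  rw [hfst]
  refine ⟨hys, ?_, fun x hx => ?_⟩
  · simp only [reflA, Prod.smul_snd, Prod.snd_add, Prod.snd_sub, smul_eq_mul, nsmul_eq_mul]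
    push_cast
    ring
  · have h := hmin (x, f x) ⟨hx, rfl⟩
    simp only [dist2, reflA] at h
    rw [Real.sqrt_le_sqrt_iff (by positivity), norm_sub_rev z.1 y, norm_sub_rev z.1 x] at h
    linarith

/-- First-order optimality condition for an interior minimizer `y` of
`‖x - a‖² + (f x + ρ)²` over `s`. -/
theorem sdiffAt.sub_add_smul_eq_zero {X : Type*} [NormedAddCommGroup X] [InnerProductSpace ℝ X]
    {s : Set X} {f : X → ℝ} {v y a : X} {ρ : ℝ} (hd : sdiffAt s f v y)
    (hmin : ∀ x ∈ s, ‖y - a‖ ^ 2 + (f y + ρ) ^ 2 ≤ ‖x - a‖ ^ 2 + (f x + ρ) ^ 2) :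
    y - a + (f y + ρ) • v = 0 := by
  obtain ⟨⟨ε, hε, hball⟩, hf⟩ := hd
  have hloc : IsLocalMin (fun x => ‖x - a‖ ^ 2 + (f x + ρ) ^ 2) y := by
    filter_upwards [Metric.ball_mem_nhds y hε] with x hx using hmin x (hball hx)
  have hder := ((((hasFDerivAt_id (𝕜 := ℝ) y).sub_const a).norm_sq).add
    ((hf.hasFDerivAt.add_const ρ).pow 2))
  refine ext_inner_right ℝ fun d => ?_
  have h := congrArg (fun L => L d) (hloc.hasFDerivAt_eq_zero hder)
  simp only [id_eq, add_apply, smul_apply, ContinuousLinearMap.comp_apply,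
    ContinuousLinearMap.id_apply, innerSL_apply_apply, zero_apply,
    nsmul_eq_mul, smul_eq_mul, Nat.cast_ofNat, Nat.add_one_sub_one, pow_one] at h
  rw [inner_add_left, real_inner_smul_left, inner_zero_left]
  linarith

/-- Lyapunov-type convergence theorem for the DRA, second part.  In the setting of the
Lyapunov convergence theorem (hypotheses (i), (ii) and the DR-sequence condition),
suppose additionally that `closure D ∩ f⁻¹(0) = {x̄}` with `x̄ ∈ D`, and that `F` is
continuous at `x̄` (relative to `D`).  Then `(z_n)` converges to a point `z̄` with
`P_A(z̄) = (x̄, 0) ∈ A ∩ B`.  If moreover `f` is strictly differentiable at `x̄` with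
`∇f(x̄) ≠ 0` and `f|_D` is continuous at `x̄`, then `(z_n)` converges to
`(x̄, 0) ∈ A ∩ B` itself. -/
theorem stmt18 {X : Type*} [NormedAddCommGroup X] [InnerProductSpace ℝ X]
    [FiniteDimensional ℝ X]
    (s : Set X) (f : X → ℝ) (hs : s.Nonempty) (hB : IsClosed (grph s f))
    (D : Set X) (hDne : D.Nonempty) (hDconv : Convex ℝ D)
    (sF : Set X) (F : X → ℝ) (hsF : sF.Nonempty) (hFconv : ConvexOn ℝ sF F)
    (hDsF : D ⊆ sF)
    (hFcoer : ∀ M : ℝ, ∃ R : ℝ, ∀ x ∈ sF, R ≤ ‖x‖ → M ≤ F x)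
    (g : X → X)
    (hdiff : ∀ x ∈ D, ¬(x ∈ s ∧ f x = 0) → sdiffAt s f (g x) x)
    (hsub1 : ∀ x ∈ D, x ∈ s → f x ≠ 0 → g x ≠ 0 →
      ((f x / ‖g x‖ ^ 2) • g x) ∈ subdiff sF F x)
    (hsub2 : ∀ x ∈ D, x ∈ s → f x = 0 → (0 : X) ∈ subdiff sF F x)
    (z : ℕ → X × ℝ) (hz0 : (z 0).1 ∈ s) (hz : ∀ n, z (n + 1) ∈ drT s f (z n))
    (n₀ : ℕ) (hzD : ∀ n ≥ n₀, (z n).1 ∈ D)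
    (hcrit : ∀ n ≥ n₀, f ((z (n + 1)).1) = 0 ∨ g ((z (n + 1)).1) ≠ 0)
    (xbar : X) (hxD : xbar ∈ D)
    (hsingle : closure D ∩ {x | x ∈ s ∧ f x = 0} = {xbar})
    (hFcont : ContinuousWithinAt F D xbar) :
    (∃ zbar : X × ℝ, Tendsto z atTop (nhds zbar) ∧ zbar.1 = xbar) ∧
    (∀ gbar : X, sdiffAt s f gbar xbar → gbar ≠ 0 → ContinuousWithinAt f D xbar →
      Tendsto z atTop (nhds (xbar, (0 : ℝ)))) := by
  have hxbar : xbar ∈ closure D ∩ {x | x ∈ s ∧ f x = 0} := hsingle ▸ mem_singleton xbar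
  obtain ⟨-, hxs, hfx⟩ := hxbar
  have hFmin : ∀ y ∈ sF, F xbar ≤ F y := fun y hy => by
    simpa using (hsub2 xbar hxD hxs hfx).2 y hy
  set V : ℕ → ℝ := fun n => F (z n).1 + (z n).2 ^ 2 / 2 with hV
  have hdec : ∀ n ≥ n₀, V (n + 1) + f (z (n + 1)).1 ^ 2 / 2 ≤ V n := by
    intro n hn
    obtain ⟨hys, hρ, hmin⟩ := drT_step (hz n)
    have hyD := hzD (n + 1) (by omega)
    have hxF := hDsF (hzD n hn)
    simp only [hV]
    by_cases hf0 : f (z (n + 1)).1 = 0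
    · have h := (hsub2 _ hyD hys hf0).2 _ hxF
      simp only [inner_zero_left, add_zero] at h
      rw [hρ, hf0]
      linarith
    · have hg := (hcrit n hn).resolve_left hf0
      have hopt := (hdiff _ hyD fun h => hf0 h.2).sub_add_smul_eq_zero hmin
      have hstep : (z n).1 - (z (n + 1)).1 =
          (f (z (n + 1)).1 + (z n).2) • g (z (n + 1)).1 := by
        rw [← sub_eq_zero, ← neg_eq_zero, ← hopt]
        abel
      have h := (hsub1 _ hyD hys hf0 hg).2 _ hxF
      rw [hstep, inner_smul_left, inner_smul_right, real_inner_self_eq_norm_sq] at h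
      have hgn : ‖g (z (n + 1)).1‖ ≠ 0 := norm_ne_zero_iff.2 hg
      have hcancel : f (z (n + 1)).1 / ‖g (z (n + 1)).1‖ ^ 2 *
          ((f (z (n + 1)).1 + (z n).2) * ‖g (z (n + 1)).1‖ ^ 2) =
          f (z (n + 1)).1 * (f (z (n + 1)).1 + (z n).2) := by
        field_simp
      simp only [conj_trivial] at h
      rw [hcancel] at h
      rw [hρ]
      linarith
  have hanti : Antitone fun k => V (k + n₀) := antitone_nat_of_succ_le fun k => by
    have h := hdec (k + n₀) (by omega)
    rw [show k + 1 + n₀ = k + n₀ + 1 by omega]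
    linarith [sq_nonneg (f (z (k + n₀ + 1)).1)]
  have hbdd : BddBelow (range fun k => V (k + n₀)) := by
    refine ⟨F xbar, ?_⟩
    rintro _ ⟨k, rfl⟩
    have h := hFmin _ (hDsF (hzD (k + n₀) (by omega)))
    simp only [hV]
    linarith [sq_nonneg (z (k + n₀)).2]
  obtain ⟨l, hl⟩ : ∃ l, Tendsto V atTop (nhds l) :=
    ⟨_, (tendsto_add_atTop_iff_nat n₀).1 (tendsto_atTop_ciInf hanti hbdd)⟩
  have hf_succ : Tendsto (fun n => f (z (n + 1)).1) atTop (nhds 0) := by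
    have hdiffV : Tendsto (fun n => 2 * (V n - V (n + 1))) atTop (nhds 0) := by
      simpa using (hl.sub (hl.comp (tendsto_add_atTop_nat 1))).const_mul 2
    have hsq : Tendsto (fun n => f (z (n + 1)).1 ^ 2) atTop (nhds 0) := by
      refine squeeze_zero' (Eventually.of_forall fun n => sq_nonneg _) ?_ hdiffV
      filter_upwards [eventually_ge_atTop n₀] with n hn
      linarith [hdec n hn]
    rw [tendsto_zero_iff_abs_tendsto_zero]
    simpa [Real.sqrt_sq_eq_abs, Function.comp_def] using hsq.sqrt
  have hf_lim : Tendsto (fun n => f (z n).1) atTop (nhds 0) :=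
    (tendsto_add_atTop_iff_nat 1).1 hf_succ
  have hzs : ∀ n, (z n).1 ∈ s := fun n => by
    cases n with
    | zero => exact hz0
    | succ n => exact (drT_step (hz n)).1
  obtain ⟨R, hR⟩ := hFcoer (V n₀ + 1)
  have hmem : ∀ᶠ n in atTop, (z n).1 ∈ closedBall (0 : X) R := by
    filter_upwards [eventually_ge_atTop n₀] with n hn
    rw [mem_closedBall_zero_iff]
    by_contra! hlt
    have h1 := hR _ (hDsF (hzD n hn)) hlt.le
    have h2 : V n ≤ V n₀ := by
      simpa [Nat.sub_add_cancel hn] using hanti (Nat.zero_le (n - n₀))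
    simp only [hV] at h1 h2
    linarith [sq_nonneg (z n).2]
  have hx_lim : Tendsto (fun n => (z n).1) atTop (nhds xbar) := by
    refine (isCompact_closedBall (0 : X) R).tendsto_nhds_of_unique_mapClusterPt hmem ?_
    intro y _ hy
    obtain ⟨φ, hφ, hlim⟩ := MapClusterPt.tendsto_subseq hy
    have hyB : (y, (0 : ℝ)) ∈ grph s f :=
      hB.mem_of_tendsto (hlim.prodMk_nhds (hf_lim.comp hφ.tendsto_atTop))
        (Eventually.of_forall fun n => ⟨hzs _, rfl⟩)
    have hyD : y ∈ closure D := by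
      refine mem_closure_of_tendsto hlim ?_
      filter_upwards [hφ.tendsto_atTop.eventually_ge_atTop n₀] with n hn using hzD _ hn
    have : y ∈ ({xbar} : Set X) := hsingle ▸ ⟨hyD, hyB⟩
    exact this
  have hF_lim : Tendsto (fun n => F (z n).1) atTop (nhds (F xbar)) :=
    hFcont.tendsto.comp (tendsto_nhdsWithin_iff.2
      ⟨hx_lim, (eventually_ge_atTop n₀).mono fun n hn => hzD n hn⟩)
  have hρ_sq : Tendsto (fun n => (z n).2 ^ 2) atTop (nhds (2 * (l - F xbar))) := by
    refine ((hl.sub hF_lim).const_mul 2).congr fun n => ?_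
    simp only [hV]
    ring
  obtain ⟨ρ, hρ⟩ := exists_tendsto_of_sq_of_increments hρ_sq (hf_succ.congr fun n => by
    rw [(drT_step (hz n)).2.1]
    ring)
  have hz_lim : Tendsto z atTop (nhds (xbar, ρ)) := hx_lim.prodMk_nhds hρ
  refine ⟨⟨(xbar, ρ), hz_lim, rfl⟩, fun gbar hgbar hgne _ => ?_⟩
  have hmin : ∀ x ∈ s, ‖xbar - xbar‖ ^ 2 + (f xbar + ρ) ^ 2 ≤
      ‖x - xbar‖ ^ 2 + (f x + ρ) ^ 2 := by
    intro x hx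
    rw [hfx]
    refine le_of_tendsto_of_tendsto'
      ((((hx_lim.comp (tendsto_add_atTop_nat 1)).sub hx_lim).norm.pow 2).add
        ((hf_succ.add hρ).pow 2))
      (((tendsto_const_nhds.sub hx_lim).norm.pow 2).add ((tendsto_const_nhds.add hρ).pow 2))
      fun n => (drT_step (hz n)).2.2 x hx
  have hopt := hgbar.sub_add_smul_eq_zero hmin
  rw [hfx, sub_self, zero_add, zero_add] at hopt
  rwa [(smul_eq_zero.1 hopt).resolve_right hgne] at hz_lim
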